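/- Let d ≥ 1, let X ⊆ ℝ^d be nonempty, closed and convex, and let f : ℝ^d → ℝ be differentiable with ‖∇f(x) − ∇f(y)‖ ≤ L‖x − y‖ for all x, y ∈ ℝ^d (L > 0). Let η, γ, τ, t, ε̂ > 0 and let x^k, x^{k+1} ∈ X and y^{k+1}, ξ^{k+1}, Γ^{k+1}, G^k ∈ ℝ^d satisfy: (i) ⟨x^{k+1} − x^k + η G^k + ξ^{k+1} + Γ^{k+1}, x − x^{k+1}⟩ ≥ 0 for all x ∈ X; (ii) ‖Γ^{k+1}‖ ≤ ε̂ and ‖x^{k+1} − y^{k+1}‖₁ ≤ ε̂. Then, writing Δx^{k+1} = x^{k+1} − x^k and g^k = ∇f(x^k), (1/η − L/2 − γ/(2η)) ‖Δx^{k+1}‖² + (1/η) ⟨ξ^{k+1}, y^{k+1} − x^k⟩ ≤ f(x^k) − f(x^{k+1}) + ((τ + t)/2) ‖g^k − G^k‖∞² + (1/(2τ) + 1/(2ηγ)) ε̂² + (1/(2t)) ‖y^{k+1} − x^k‖₁² + (ε̂/η) ‖ξ^{k+1}‖∞. -/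

import Mathlib

open MeasureTheory ProbabilityTheory Finset
open scoped BigOperators

local notation "⟪" x ", " y "⟫" => @inner ℝ _ _ x y

noncomputable def norm1 {d : ℕ} (x : EuclideanSpace ℝ (Fin d)) : ℝ := ∑ i, |x i|

noncomputable def normInf {d : ℕ} (x : EuclideanSpace ℝ (Fin d)) : ℝ := ⨆ i, |x i|

/-- **Descent lemma**: a function with `L`-Lipschitz gradient is bounded above by its quadratic
model. -/
theorem le_add_inner_gradient_add_sq {E : Type*} [NormedAddCommGroup E] [InnerProductSpace ℝ E]
    [CompleteSpace E] {f : E → ℝ} (hf : Differentiable ℝ f) {L : ℝ}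
    (hLip : ∀ a b : E, ‖gradient f a - gradient f b‖ ≤ L * ‖a - b‖) (x v : E) :
    f (x + v) ≤ f x + ⟪gradient f x, v⟫ + L / 2 * ‖v‖ ^ 2 := by
  have hderiv : ∀ s : ℝ, HasDerivAt
      (fun s : ℝ => f (x + s • v) - s * ⟪gradient f x, v⟫ - L / 2 * ‖v‖ ^ 2 * s ^ 2)
      (⟪gradient f (x + s • v) - gradient f x, v⟫ - L * ‖v‖ ^ 2 * s) s := by
    intro s
    have h1 : HasDerivAt (fun s : ℝ => x + s • v) v s := by
      simpa using ((hasDerivAt_id s).smul_const v).const_add x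
    have h2 := (hf (x + s • v)).hasGradientAt.hasFDerivAt.comp_hasDerivAt s h1
    have h3 := (h2.sub ((hasDerivAt_id s).mul_const ⟪gradient f x, v⟫)).sub
      ((hasDerivAt_pow 2 s).const_mul (L / 2 * ‖v‖ ^ 2))
    refine h3.congr_deriv ?_
    simp only [InnerProductSpace.toDual_apply_apply, inner_sub_left]
    push_cast
    ring
  have hanti := antitoneOn_of_deriv_nonpos (convex_Icc (0 : ℝ) 1)
    (fun s _ => (hderiv s).continuousAt.continuousWithinAt)
    (fun s _ => (hderiv s).differentiableAt.differentiableWithinAt) (fun s hs => by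
      rw [interior_Icc] at hs
      rw [(hderiv s).deriv]
      have h1 := real_inner_le_norm (gradient f (x + s • v) - gradient f x) v
      have h2 := hLip (x + s • v) x
      rw [add_sub_cancel_left, norm_smul, Real.norm_of_nonneg hs.1.le] at h2
      nlinarith [mul_le_mul_of_nonneg_right h2 (norm_nonneg v)])
  have h := hanti (Set.left_mem_Icc.2 zero_le_one) (Set.right_mem_Icc.2 zero_le_one) zero_le_one
  simp only [one_smul, zero_smul, add_zero, one_mul, zero_mul, one_pow, mul_one, sub_zero,
    zero_pow two_ne_zero, mul_zero] at h
  linarith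

theorem abs_apply_le_normInf {d : ℕ} (a : EuclideanSpace ℝ (Fin d)) (i : Fin d) :
    |a i| ≤ normInf a :=
  le_ciSup (f := fun i => |a i|) (Set.finite_range _).bddAbove i

theorem normInf_nonneg {d : ℕ} (a : EuclideanSpace ℝ (Fin d)) : 0 ≤ normInf a :=
  Real.iSup_nonneg fun _ => abs_nonneg _

/-- **Hölder's inequality** for the pairing of `ℓ∞` with `ℓ₁`. -/
theorem abs_inner_le_normInf_mul_norm1 {d : ℕ} (a b : EuclideanSpace ℝ (Fin d)) :
    |⟪a, b⟫| ≤ normInf a * norm1 b := by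
  rw [PiLp.inner_apply, norm1, Finset.mul_sum]
  refine (Finset.abs_sum_le_sum_abs _ _).trans (Finset.sum_le_sum fun i _ => ?_)
  rw [show inner ℝ (a i) (b i) = a i * b i from mul_comm _ _, abs_mul]
  exact mul_le_mul_of_nonneg_right (abs_apply_le_normInf a i) (abs_nonneg _)

/-- **Young's inequality** with a weight. -/
theorem mul_le_weighted_sq_add_sq {c : ℝ} (hc : 0 < c) (a b : ℝ) :
    a * b ≤ c / 2 * a ^ 2 + 1 / (2 * c) * b ^ 2 := by
  have h : c / 2 * a ^ 2 + 1 / (2 * c) * b ^ 2 - a * b = (c * a - b) ^ 2 / (2 * c) := by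
    field_simp
    ring
  have : 0 ≤ (c * a - b) ^ 2 / (2 * c) := by positivity
  linarith

theorem stmt_8 {d : ℕ} (hd : 1 ≤ d)
    (X : Set (EuclideanSpace ℝ (Fin d)))
    (hXne : X.Nonempty) (hXcl : IsClosed X) (hXcv : Convex ℝ X)
    (f : EuclideanSpace ℝ (Fin d) → ℝ) (hf : Differentiable ℝ f)
    (L : ℝ) (hL : 0 < L)
    (hLip : ∀ a b : EuclideanSpace ℝ (Fin d), ‖gradient f a - gradient f b‖ ≤ L * ‖a - b‖)
    (η γ τ t ε : ℝ) (hη : 0 < η) (hγ : 0 < γ) (hτ : 0 < τ) (ht : 0 < t) (hε : 0 < ε)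
    (xk xk1 : EuclideanSpace ℝ (Fin d)) (hxk : xk ∈ X) (hxk1 : xk1 ∈ X)
    (yk1 ξ Γ G : EuclideanSpace ℝ (Fin d))
    (hvi : ∀ z ∈ X, ⟪xk1 - xk + η • G + ξ + Γ, z - xk1⟫ ≥ 0)
    (hΓ : ‖Γ‖ ≤ ε) (hy : norm1 (xk1 - yk1) ≤ ε) :
    (1 / η - L / 2 - γ / (2 * η)) * ‖xk1 - xk‖ ^ 2 + (1 / η) * ⟪ξ, yk1 - xk⟫
      ≤ f xk - f xk1 + ((τ + t) / 2) * (normInf (gradient f xk - G)) ^ 2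
        + (1 / (2 * τ) + 1 / (2 * η * γ)) * ε ^ 2
        + (1 / (2 * t)) * (norm1 (yk1 - xk)) ^ 2
        + (ε / η) * normInf ξ := by
  obtain ⟨v, rfl⟩ : ∃ v, xk1 = xk + v := ⟨xk1 - xk, by abel⟩
  have hdesc := le_add_inner_gradient_add_sq hf hLip xk v
  have hsplit : ∀ a : EuclideanSpace ℝ (Fin d),
      ⟪a, v⟫ = ⟪a, xk + v - yk1⟫ + ⟪a, yk1 - xk⟫ := fun a => by
    rw [← inner_add_right]
    congr 1
    abel
  have hopt := hvi xk hxk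
  rw [show xk - (xk + v) = -v by abel, add_sub_cancel_left, inner_neg_right, inner_add_left,
    inner_add_left, inner_add_left, real_inner_smul_left, real_inner_self_eq_norm_sq] at hopt
  have hΓv : -⟪Γ, v⟫ ≤ γ / 2 * ‖v‖ ^ 2 + 1 / (2 * γ) * ε ^ 2 := by
    have h1 := (abs_le.1 (abs_real_inner_le_norm Γ v)).1
    have h2 := mul_le_mul_of_nonneg_right hΓ (norm_nonneg v)
    linarith [mul_le_weighted_sq_add_sq hγ ‖v‖ ε]
  have hξ : -⟪ξ, xk + v - yk1⟫ ≤ ε * normInf ξ := by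
    have h1 := (abs_le.1 (abs_inner_le_normInf_mul_norm1 ξ (xk + v - yk1))).1
    linarith [mul_le_mul_of_nonneg_left hy (normInf_nonneg ξ)]
  have hgrad : ⟪gradient f xk, v⟫ - ⟪G, v⟫ ≤ (τ + t) / 2 * normInf (gradient f xk - G) ^ 2
      + 1 / (2 * τ) * ε ^ 2 + 1 / (2 * t) * norm1 (yk1 - xk) ^ 2 := by
    rw [← inner_sub_left, hsplit]
    have h1 := (abs_le.1 (abs_inner_le_normInf_mul_norm1 (gradient f xk - G) (xk + v - yk1))).2
    have h2 := (abs_le.1 (abs_inner_le_normInf_mul_norm1 (gradient f xk - G) (yk1 - xk))).2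
    have h3 := mul_le_mul_of_nonneg_left hy (normInf_nonneg (gradient f xk - G))
    linarith [mul_le_weighted_sq_add_sq hτ (normInf (gradient f xk - G)) ε,
      mul_le_weighted_sq_add_sq ht (normInf (gradient f xk - G)) (norm1 (yk1 - xk))]
  have hscaled : ‖v‖ ^ 2 + ⟪ξ, yk1 - xk⟫ + η * ⟪G, v⟫
      ≤ γ / 2 * ‖v‖ ^ 2 + 1 / (2 * γ) * ε ^ 2 + ε * normInf ξ := by
    linarith [hsplit ξ]
  have hdiv : 1 / η * ‖v‖ ^ 2 + 1 / η * ⟪ξ, yk1 - xk⟫ + ⟪G, v⟫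
      ≤ γ / (2 * η) * ‖v‖ ^ 2 + 1 / (2 * η * γ) * ε ^ 2 + ε / η * normInf ξ := by
    have h := div_le_div_of_nonneg_right hscaled hη.le
    rw [show ∀ a b c : ℝ, (a + b + η * c) / η = 1 / η * a + 1 / η * b + c by
        intros; field_simp] at h
    refine h.trans_eq ?_
    field_simp
  rw [add_sub_cancel_left]
  linarith
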